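/- (Dimension 16 case of the main theorem.) Define P₁₆(z) = (1 − z)². For every real y > 0, P₁₆(z(y)) ≥ P₁₆(1/4) > 0; consequently the secrecy function Ξ(y) = P₁₆(z(y))^{-1} of the extremal even unimodular lattice in dimension 16 satisfies Ξ(y) ≤ Ξ(1) = P₁₆(1/4)^{-1}. -/

import Mathlib

/-- Jacobi theta constant θ₂ on the imaginary axis. -/
noncomputable def theta2 (y : ℝ) : ℝ := ∑' n : ℤ, Real.exp (-Real.pi * y * (n + 1/2)^2)

/-- Jacobi theta constant θ₃ on the imaginary axis. -/
noncomputable def theta3 (y : ℝ) : ℝ := ∑' n : ℤ, Real.exp (-Real.pi * y * n^2)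

/-- Jacobi theta constant θ₄ on the imaginary axis. -/
noncomputable def theta4 (y : ℝ) : ℝ := ∑' n : ℤ, (-1 : ℝ)^n * Real.exp (-Real.pi * y * n^2)

/-- The function z(y) = θ₂(y)⁴θ₄(y)⁴/θ₃(y)⁸. -/
noncomputable def zfun (y : ℝ) : ℝ := theta2 y ^ 4 * theta4 y ^ 4 / theta3 y ^ 8

/-- Denominator polynomial of the secrecy function of the extremal even
unimodular lattice in dimension 16. -/
noncomputable def P16 (z : ℝ) : ℝ := (1 - z) ^ 2

/-- A double series over `ℤ × ℤ` splits according to the parity of the sum of the coordinates. -/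
theorem tsum_int_prod_eq_add_of_parity {f : ℤ × ℤ → ℝ} (hf : Summable f) :
    ∑' p, f p = (∑' p : ℤ × ℤ, f (p.1 + p.2, p.1 - p.2)) +
      ∑' p : ℤ × ℤ, f (p.1 + p.2 + 1, p.1 - p.2) := by
  let e : (ℤ × ℤ) ⊕ (ℤ × ℤ) → ℤ × ℤ :=
    Sum.elim (fun p => (p.1 + p.2, p.1 - p.2)) (fun p => (p.1 + p.2 + 1, p.1 - p.2))
  have he : Function.Bijective e := by
    constructor
    · rintro (⟨a, b⟩ | ⟨a, b⟩) (⟨c, d⟩ | ⟨c, d⟩) h <;>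
        simp only [e, Sum.elim_inl, Sum.elim_inr, Prod.mk.injEq, Sum.inl.injEq, Sum.inr.injEq,
          reduceCtorEq] at h ⊢ <;> omega
    · rintro ⟨m, n⟩
      rcases Int.even_or_odd' (m + n) with ⟨k, hk | hk⟩
      · exact ⟨Sum.inl (k, k - n), by simp only [e, Sum.elim_inl, Prod.mk.injEq]; omega⟩
      · exact ⟨Sum.inr (k, k - n), by simp only [e, Sum.elim_inr, Prod.mk.injEq]; omega⟩
  have hfe : Summable (f ∘ e) := hf.comp_injective he.injective
  rw [← (Equiv.ofBijective e he).tsum_eq f]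
  exact Summable.tsum_sum (f := f ∘ e) (hfe.comp_injective Sum.inl_injective)
    (hfe.comp_injective Sum.inr_injective)

theorem summable_theta3 {y : ℝ} (hy : 0 < y) :
    Summable fun n : ℤ => Real.exp (-Real.pi * y * n ^ 2) := by
  simpa [mul_assoc] using summable_pow_mul_jacobiTheta₂_term_bound 0 hy 0

theorem summable_theta2 {y : ℝ} (hy : 0 < y) :
    Summable fun n : ℤ => Real.exp (-Real.pi * y * (n + 1 / 2) ^ 2) := by
  refine Summable.of_nonneg_of_le (fun _ => (Real.exp_pos _).le) (fun n => ?_)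
    (summable_pow_mul_jacobiTheta₂_term_bound (y / 2) hy 0)
  rw [pow_zero, one_mul, Real.exp_le_exp]
  have habs : -|(n : ℝ)| ≤ n := neg_abs_le _
  have hpy : 0 < Real.pi * y := mul_pos Real.pi_pos hy
  push_cast
  nlinarith

theorem summable_norm_theta4 {y : ℝ} (hy : 0 < y) :
    Summable fun n : ℤ => ‖(-1 : ℝ) ^ n * Real.exp (-Real.pi * y * n ^ 2)‖ := by
  simpa [norm_mul, norm_zpow] using summable_theta3 hy

theorem theta3_pos {y : ℝ} (hy : 0 < y) : 0 < theta3 y :=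
  (summable_theta3 hy).tsum_pos (fun _ => (Real.exp_pos _).le) 0 (Real.exp_pos _)

theorem theta3_sq {y : ℝ} (hy : 0 < y) :
    theta3 y ^ 2 = theta3 (2 * y) ^ 2 + theta2 (2 * y) ^ 2 := by
  have hy2 : 0 < 2 * y := by positivity
  have h := (summable_theta3 hy).norm
  have h3 := (summable_theta3 hy2).norm
  have h2 := (summable_theta2 hy2).norm
  simp only [sq (theta3 _), sq (theta2 _)]
  unfold theta3 theta2
  rw [tsum_mul_tsum_of_summable_norm h h, tsum_mul_tsum_of_summable_norm h3 h3,
    tsum_mul_tsum_of_summable_norm h2 h2,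
    tsum_int_prod_eq_add_of_parity (summable_mul_of_summable_norm h h)]
  congr 1 <;> refine tsum_congr fun p => ?_ <;> simp only [← Real.exp_add] <;> push_cast <;>
    ring_nf

theorem theta4_sq {y : ℝ} (hy : 0 < y) :
    theta4 y ^ 2 = theta3 (2 * y) ^ 2 - theta2 (2 * y) ^ 2 := by
  have hy2 : 0 < 2 * y := by positivity
  have h := summable_norm_theta4 hy
  have h3 := (summable_theta3 hy2).norm
  have h2 := (summable_theta2 hy2).norm
  simp only [sq (theta4 _), sq (theta3 _), sq (theta2 _), sub_eq_add_neg]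
  unfold theta4 theta3 theta2
  rw [tsum_mul_tsum_of_summable_norm h h, tsum_mul_tsum_of_summable_norm h3 h3,
    tsum_mul_tsum_of_summable_norm h2 h2,
    tsum_int_prod_eq_add_of_parity (summable_mul_of_summable_norm h h), ← tsum_neg]
  congr 1 <;> refine tsum_congr fun p => ?_ <;>
    rw [mul_mul_mul_comm, ← zpow_add₀ (by norm_num), ← Real.exp_add, ← Real.exp_add]
  · rw [Even.neg_one_zpow ⟨p.1, by ring⟩]
    push_cast
    ring_nf
  · rw [Odd.neg_one_zpow ⟨p.1, by ring⟩]
    push_cast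
    ring_nf

/-- The alternating analogue of `theta2` vanishes, by the symmetry `n ↦ -1 - n`. -/
theorem tsum_neg_one_zpow_mul_exp_half_eq_zero (y : ℝ) :
    ∑' n : ℤ, (-1 : ℝ) ^ n * Real.exp (-Real.pi * y * (n + 1 / 2) ^ 2) = 0 := by
  suffices h : ∑' n : ℤ, (-1 : ℝ) ^ n * Real.exp (-Real.pi * y * (n + 1 / 2) ^ 2) =
      -∑' n : ℤ, (-1 : ℝ) ^ n * Real.exp (-Real.pi * y * (n + 1 / 2) ^ 2) by linarith
  rw [← tsum_neg]
  conv_lhs => rw [← (Equiv.subLeft (-1 : ℤ)).tsum_eq]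
  refine tsum_congr fun n => ?_
  rw [Equiv.subLeft_apply, zpow_sub₀ (by norm_num), zpow_neg_one]
  rcases Int.even_or_odd n with hn | hn <;>
    simp only [hn.neg_one_zpow] <;> push_cast <;> ring_nf

theorem theta3_mul_theta4 {y : ℝ} (hy : 0 < y) :
    theta3 y * theta4 y = theta4 (2 * y) ^ 2 := by
  have hy2 : 0 < 2 * y := by positivity
  have h3 := (summable_theta3 hy).norm
  have h4 := summable_norm_theta4 hy
  have h4' := summable_norm_theta4 hy2
  have h2 : Summable fun n : ℤ =>
      ‖(-1 : ℝ) ^ n * Real.exp (-Real.pi * (2 * y) * (n + 1 / 2) ^ 2)‖ := by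
    simpa [norm_mul, norm_zpow] using summable_theta2 hy2
  have hsign (k l : ℤ) : (-1 : ℝ) ^ (k - l) = (-1) ^ k * (-1) ^ l := by
    rw [zpow_sub₀ (by norm_num)]
    rcases Int.even_or_odd l with hl | hl <;> simp [hl.neg_one_zpow, div_neg]
  rw [← add_zero (theta4 (2 * y) ^ 2), ← mul_zero (0 : ℝ),
    ← tsum_neg_one_zpow_mul_exp_half_eq_zero (2 * y), sq]
  unfold theta3 theta4
  rw [tsum_mul_tsum_of_summable_norm h3 h4, tsum_mul_tsum_of_summable_norm h4' h4',
    tsum_mul_tsum_of_summable_norm h2 h2,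
    tsum_int_prod_eq_add_of_parity (summable_mul_of_summable_norm h3 h4)]
  congr 1 <;> refine tsum_congr fun p => ?_ <;>
    rw [hsign, mul_left_comm, ← Real.exp_add, mul_mul_mul_comm, ← Real.exp_add] <;>
    push_cast <;> ring_nf

/-- Jacobi's identity `θ₃⁴ = θ₂⁴ + θ₄⁴`. -/
theorem theta3_pow_four {y : ℝ} (hy : 0 < y) :
    theta3 y ^ 4 = theta2 y ^ 4 + theta4 y ^ 4 := by
  have hy2 : 0 < y / 2 := by positivity
  have h3 := theta3_sq hy2
  have h4 := theta4_sq hy2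
  have h34 := theta3_mul_theta4 hy2
  rw [mul_div_cancel₀ y two_ne_zero] at h3 h4 h34
  calc theta3 y ^ 4
      = theta2 y ^ 4 + (theta3 y ^ 2 + theta2 y ^ 2) * (theta3 y ^ 2 - theta2 y ^ 2) := by ring
    _ = theta2 y ^ 4 + (theta3 (y / 2) * theta4 (y / 2)) ^ 2 := by rw [← h3, ← h4]; ring
    _ = theta2 y ^ 4 + theta4 y ^ 4 := by rw [h34]; ring

/-- Poisson summation at the fixed point `y = 1`. -/
theorem theta4_one : theta4 1 = theta2 1 := by
  have h := Complex.tsum_exp_neg_quadratic (a := 1) (by simp) (-Complex.I / 2)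
  rw [Complex.one_cpow, div_one, one_mul] at h
  apply Complex.ofReal_injective
  unfold theta4 theta2
  rw [Complex.ofReal_tsum, Complex.ofReal_tsum]
  convert h using 3 with n n
  · have hpi : Complex.exp (2 * Real.pi * (-Complex.I / 2) * n) = (-1) ^ n := by
      rw [show (2 * Real.pi * (-Complex.I / 2) * n : ℂ) = n * -(Real.pi * Complex.I) by ring,
        Complex.exp_int_mul, Complex.exp_neg, Complex.exp_pi_mul_I]
      norm_num
    rw [Complex.exp_add, hpi]
    push_cast
    ring
  · have hI : Complex.I * (-Complex.I / 2) = 1 / 2 := by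
      linear_combination (-1 / 2 : ℂ) * Complex.I_sq
    rw [hI]
    push_cast
    ring_nf

theorem zfun_le {y : ℝ} (hy : 0 < y) : zfun y ≤ 1 / 4 := by
  have h3 := theta3_pos hy
  rw [zfun, div_le_iff₀ (by positivity)]
  have h : theta3 y ^ 8 = (theta2 y ^ 4 + theta4 y ^ 4) ^ 2 := by
    rw [← theta3_pow_four hy]; ring
  rw [h]
  nlinarith [sq_nonneg (theta2 y ^ 4 - theta4 y ^ 4)]

theorem zfun_one : zfun 1 = 1 / 4 := by
  have h3 := theta3_pos one_pos
  have h := theta3_pow_four one_pos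
  rw [theta4_one] at h
  have h2 : theta2 1 ^ 4 = theta3 1 ^ 4 / 2 := by linarith
  rw [zfun, theta4_one, h2]
  field_simp
  norm_num

theorem P16_le_of_le {z w : ℝ} (hzw : z ≤ w) (hw : w ≤ 1) : P16 w ≤ P16 z :=
  pow_le_pow_left₀ (by linarith) (by linarith) 2

theorem secrecy_dim16 :
    (∀ y : ℝ, 0 < y → P16 (1 / 4) ≤ P16 (zfun y)) ∧ 0 < P16 (1 / 4) ∧
      (∀ y : ℝ, 0 < y → (P16 (zfun y))⁻¹ ≤ (P16 (zfun 1))⁻¹) ∧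
      (P16 (zfun 1))⁻¹ = (P16 (1 / 4))⁻¹ := by
  have hpos : 0 < P16 (1 / 4) := by norm_num [P16]
  have hle (y : ℝ) (hy : 0 < y) : P16 (1 / 4) ≤ P16 (zfun y) :=
    P16_le_of_le (zfun_le hy) (by norm_num)
  refine ⟨hle, hpos, fun y hy => ?_, by rw [zfun_one]⟩
  rw [zfun_one]
  exact inv_anti₀ hpos (hle y hy)
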